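/- Let T₁, T₂ be ℝ-trees, neither of which is isometric to ℝ, and let X = T₁ × T₂ be their ℓ¹ product. Let H = H₁ × H₂ ≤ Isom(T₁) × Isom(T₂) be a subgroup with H₁ and H₂ both nontrivial, such that the action of H on X is free and essential. Then, after possibly swapping the labels of H₁ and H₂, the following holds: for every point (z₁, z₂) ∈ X, H₁ = Stab_H(T₁ × {z₂}) and H₂ = Stab_H({z₁} × T₂), and the induced actions H₁ ↷ T₁ × {z₂} and H₂ ↷ {z₁} × T₂ are free and essential. Consequently, if the action of H on X is in addition cobounded (respectively cocompact, transitive), then these two factor actions are cobounded (respectively cocompact, transitive). -/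

import Mathlib

open Cardinal

noncomputable section

/-- A metric space is *geodesic* if every pair of points is joined by a geodesic. -/
def GeodesicSpace (T : Type) [MetricSpace T] : Prop :=
  ∀ x y : T, ∃ γ : ℝ → T, γ 0 = x ∧ γ (dist x y) = y ∧
    ∀ s ∈ Set.Icc (0:ℝ) (dist x y), ∀ t ∈ Set.Icc (0:ℝ) (dist x y),
      dist (γ s) (γ t) = |s - t|

/-- 0-hyperbolicity: for all basepoints `p`, the Gromov products satisfy
`(x,y)_p ≥ min ((x,z)_p, (z,y)_p)`. -/
def ZeroHyp (T : Type) [MetricSpace T] : Prop :=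
  ∀ p x y z : T,
    min ((dist x p + dist z p - dist x z) / 2) ((dist z p + dist y p - dist z y) / 2) ≤
      (dist x p + dist y p - dist x y) / 2

/-- An ℝ-tree: a geodesic metric space which is 0-hyperbolic. -/
def IsRTree (T : Type) [MetricSpace T] : Prop := GeodesicSpace T ∧ ZeroHyp T

/-- The valence of a point `x`: the cardinality of the set of connected components of
`T \ {x}`. -/
def valence (T : Type) [MetricSpace T] (x : T) : Cardinal :=
  #(ConnectedComponents {y : T // y ≠ x})

/-- An action of a group `G` by isometries, given as a map `φ : G → T → T`. -/
def IsometricAction {G T : Type} [Group G] [MetricSpace T] (φ : G → T → T) : Prop :=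
  (∀ g : G, Isometry (φ g)) ∧ (∀ x : T, φ 1 x = x) ∧
  (∀ g h : G, ∀ x : T, φ (g * h) x = φ g (φ h x))

/-- The action is free. -/
def FreeAction {G T : Type} [Group G] (φ : G → T → T) : Prop :=
  ∀ g : G, ∀ x : T, φ g x = x → g = 1

/-- The action is transitive. -/
def TransAction {G T : Type} (φ : G → T → T) : Prop :=
  ∀ x y : T, ∃ g : G, φ g x = y

/-- A line in a metric space: the image of an isometric embedding of ℝ. -/
def IsLine {T : Type} [MetricSpace T] (L : Set T) : Prop :=
  ∃ γ : ℝ → T, Isometry γ ∧ Set.range γ = L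

/-- The (setwise) stabiliser of a subset `L` under the action `φ`. -/
def setStab {G T : Type} (φ : G → T → T) (L : Set T) : Set G :=
  {g | φ g '' L = L}

/-- The ℓ¹ metric on the product of two metric spaces. -/
def l1dist2 {T₁ T₂ : Type} [MetricSpace T₁] [MetricSpace T₂] (p q : T₁ × T₂) : ℝ :=
  dist p.1 q.1 + dist p.2 q.2

section Prod

variable {T₁ T₂ H : Type} [MetricSpace T₁] [MetricSpace T₂] [Group H]

/-- The diagonal (factor-preserving) action on the ℓ¹ product. -/
def prodAct (α : H → T₁ → T₁) (β : H → T₂ → T₂) (h : H) (p : T₁ × T₂) : T₁ × T₂ :=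
  (α h p.1, β h p.2)

/-- The action of the elements of `K` on the subspace `S` of the ℓ¹ product is
*essential*: there is no proper nonempty `K`-invariant convex subspace of `S`. -/
def EssentialOn (φ : H → T₁ × T₂ → T₁ × T₂) (K : Set H) (S : Set (T₁ × T₂)) : Prop :=
  ∀ C : Set (T₁ × T₂), C ⊆ S → C.Nonempty →
    (∀ h ∈ K, φ h '' C = C) →
    (∀ x ∈ C, ∀ y ∈ C, ∀ z ∈ S, l1dist2 x z + l1dist2 z y = l1dist2 x y → z ∈ C) →
    C = S

/-- The action of the elements of `K` on the subspace `S` is free. -/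
def FreeOn (φ : H → T₁ × T₂ → T₁ × T₂) (K : Set H) (S : Set (T₁ × T₂)) : Prop :=
  ∀ h ∈ K, ∀ p ∈ S, φ h p = p → h = 1

/-- The action of the elements of `K` on the subspace `S` is cobounded. -/
def CoboundedOn (φ : H → T₁ × T₂ → T₁ × T₂) (K : Set H) (S : Set (T₁ × T₂)) : Prop :=
  ∃ x ∈ S, ∃ R : ℝ, 0 < R ∧ ∀ y ∈ S, ∃ h ∈ K, l1dist2 y (φ h x) ≤ R

/-- The action of the elements of `K` on the subspace `S` is cocompact. -/
def CocompactOn (φ : H → T₁ × T₂ → T₁ × T₂) (K : Set H) (S : Set (T₁ × T₂)) : Prop :=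
  ∃ C : Set (T₁ × T₂), C ⊆ S ∧ IsCompact C ∧ ∀ y ∈ S, ∃ h ∈ K, y ∈ φ h '' C

/-- The action of the elements of `K` on the subspace `S` is transitive. -/
def TransOn (φ : H → T₁ × T₂ → T₁ × T₂) (K : Set H) (S : Set (T₁ × T₂)) : Prop :=
  ∀ x ∈ S, ∀ y ∈ S, ∃ h ∈ K, φ h x = y

/-- The horizontal slice `T₁ × {z₂}`. -/
def slice₁ (z₂ : T₂) : Set (T₁ × T₂) := {p : T₁ × T₂ | p.2 = z₂}

/-- The vertical slice `{z₁} × T₂`. -/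
def slice₂ (z₁ : T₁) : Set (T₁ × T₂) := {p : T₁ × T₂ | p.1 = z₁}

/-- The conclusion of the lemma for an ordered pair of factors `(K₁, K₂)`. -/
def FactorConclusion (φ : H → T₁ × T₂ → T₁ × T₂) (K₁ K₂ : Subgroup H) : Prop :=
  ∀ z₁ : T₁, ∀ z₂ : T₂,
    (K₁ : Set H) = setStab φ (slice₁ z₂) ∧
    (K₂ : Set H) = setStab φ (slice₂ z₁) ∧
    FreeOn φ (K₁ : Set H) (slice₁ z₂) ∧ EssentialOn φ (K₁ : Set H) (slice₁ z₂) ∧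
    FreeOn φ (K₂ : Set H) (slice₂ z₁) ∧ EssentialOn φ (K₂ : Set H) (slice₂ z₁) ∧
    (CoboundedOn φ Set.univ Set.univ →
      CoboundedOn φ (K₁ : Set H) (slice₁ z₂) ∧ CoboundedOn φ (K₂ : Set H) (slice₂ z₁)) ∧
    (CocompactOn φ Set.univ Set.univ →
      CocompactOn φ (K₁ : Set H) (slice₁ z₂) ∧ CocompactOn φ (K₂ : Set H) (slice₂ z₁)) ∧
    (TransOn φ Set.univ Set.univ →
      TransOn φ (K₁ : Set H) (slice₁ z₂) ∧ TransOn φ (K₂ : Set H) (slice₂ z₁))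

end Prod

section RTree

variable {T : Type} [MetricSpace T]

/-- A set is convex if it contains every point lying between two of its points. -/
def IsMetricConvex (C : Set T) : Prop :=
  ∀ x ∈ C, ∀ y ∈ C, ∀ z, dist x z + dist z y = dist x y → z ∈ C

/-- The four-point condition. -/
lemma ZeroHyp.four_point (h : ZeroHyp T) (x y z w : T) :
    dist x y + dist z w ≤ dist x z + dist y w ∨ dist x y + dist z w ≤ dist x w + dist y z := by
  have h1 := h w x y z
  rw [min_le_iff, dist_comm z y] at h1
  rcases h1 with h1 | h1
  · left; linarith
  · right; linarith

lemma GeodesicSpace.exists_dist_eq (h : GeodesicSpace T) (x y : T) {t : ℝ}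
    (ht : t ∈ Set.Icc 0 (dist x y)) : ∃ m, dist x m = t ∧ dist m y = dist x y - t := by
  obtain ⟨γ, h0, h1, hγ⟩ := h x y
  have hd : (0 : ℝ) ≤ dist x y := dist_nonneg
  refine ⟨γ t, ?_, ?_⟩
  · rw [← h0, hγ 0 ⟨le_rfl, hd⟩ t ht, zero_sub, abs_neg, abs_of_nonneg ht.1]
  · have := hγ t ht (dist x y) ⟨hd, le_rfl⟩
    rw [h1, abs_sub_comm, abs_of_nonneg (by linarith [ht.2])] at this
    exact this

lemma GeodesicSpace.exists_midpoint (h : GeodesicSpace T) (x y : T) :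
    ∃ m, dist x m = dist x y / 2 ∧ dist m y = dist x y / 2 := by
  have hd : (0 : ℝ) ≤ dist x y := dist_nonneg
  obtain ⟨m, h1, h2⟩ := h.exists_dist_eq x y (t := dist x y / 2) ⟨by linarith, by linarith⟩
  exact ⟨m, h1, by linarith⟩

lemma ZeroHyp.dist_midpoint (h : ZeroHyp T) {x y m : T} (h1 : dist x m = dist x y / 2)
    (h2 : dist m y = dist x y / 2) (p : T) :
    dist m p = max (dist x p) (dist y p) - dist x y / 2 := by
  have t1 := dist_triangle x m p
  have t2 := dist_triangle y m p
  rw [dist_comm y m] at t2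
  apply le_antisymm
  · rcases h.four_point m p x y with h3 | h3
    · rw [dist_comm m x, dist_comm p y] at h3
      linarith [le_max_right (dist x p) (dist y p)]
    · rw [dist_comm p x] at h3
      linarith [le_max_left (dist x p) (dist y p)]
  · rw [sub_le_iff_le_add]
    exact max_le (by linarith) (by linarith)

lemma ZeroHyp.dist_le_of_between (h : ZeroHyp T) {x y p : T}
    (hp : dist x p + dist p y = dist x y) (q : T) :
    dist p q ≤ dist x q - dist x p ∨ dist p q ≤ dist y q - dist p y := by
  rcases h.four_point p q x y with h3 | h3
  · rw [dist_comm p x, dist_comm q y] at h3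
    right; linarith
  · rw [dist_comm q x] at h3
    left; linarith

/-- The displacement of an isometry is quasi-convex along geodesics. -/
lemma ZeroHyp.displacement_le (h : ZeroHyp T) (g : T ≃ᵢ T) {x y p : T} {c : ℝ}
    (hx : dist x (g x) ≤ c) (hy : dist y (g y) ≤ c) (hp : dist x p + dist p y = dist x y) :
    dist p (g p) ≤ c := by
  have hgp : dist (g x) (g p) + dist (g p) (g y) = dist (g x) (g y) := by
    simpa only [g.dist_eq] using hp
  have e1 := g.dist_eq x p
  have e2 := g.dist_eq p y
  have n1 : 0 ≤ dist x p := dist_nonneg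
  have n2 : 0 ≤ dist p y := dist_nonneg
  have c1 := dist_comm (g p) x
  have c2 := dist_comm (g p) y
  have c3 := dist_comm (g x) x
  have c4 := dist_comm (g y) y
  have c5 := dist_comm (g x) y
  have c6 := dist_comm (g y) x
  have c7 := dist_comm y x
  have t1 := dist_triangle x y (g y)
  have t2 := dist_triangle y x (g x)
  rcases h.dist_le_of_between hp (g p) with h1 | h1
  · rcases h.dist_le_of_between hgp x with h2 | h2 <;> linarith
  · rcases h.dist_le_of_between hgp y with h2 | h2 <;> linarith

/-- The set of points `x` such that `g x` is the midpoint of `x` and `g (g x)`; for a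
fixed-point free isometry of an ℝ-tree this is its axis. -/
def isometryAxis (g : T ≃ᵢ T) : Set T := {x | dist x (g (g x)) = 2 * dist x (g x)}

lemma ZeroHyp.dist_midpoint_map (h : ZeroHyp T) (g : T ≃ᵢ T) {x m : T}
    (h1 : dist x m = dist x (g x) / 2) (h2 : dist m (g x) = dist x (g x) / 2) :
    dist m (g m) = max (dist x (g x)) (dist x (g (g x))) - dist x (g x) := by
  have e1 : dist (g x) (g m) = dist (g x) (g (g x)) / 2 := by simpa only [g.dist_eq] using h1
  have e2 : dist (g m) (g (g x)) = dist (g x) (g (g x)) / 2 := by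
    simpa only [g.dist_eq] using h2
  have a1 := h.dist_midpoint e1 e2 m
  have a2 := h.dist_midpoint h1 h2 (g (g x))
  have e3 := g.dist_eq x (g x)
  rw [dist_comm (g m) m, dist_comm (g x) m, dist_comm (g (g x)) m, h2, a2, e3] at a1
  rw [a1, max_comm (dist x (g x)), max_eq_right]
  · ring
  · linarith [le_max_right (dist x (g (g x))) (dist x (g x))]

lemma ZeroHyp.midpoint_mem_isometryAxis (h : ZeroHyp T) (g : T ≃ᵢ T) {x m : T}
    (h1 : dist x m = dist x (g x) / 2) (h2 : dist m (g x) = dist x (g x) / 2) :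
    m ∈ isometryAxis g := by
  have hm := h.dist_midpoint_map g h1 h2
  change dist m (g (g m)) = 2 * dist m (g m)
  rcases le_or_gt (dist x (g (g x))) (dist x (g x)) with hab | hab
  · rw [max_eq_left hab, sub_self, dist_eq_zero] at hm
    simp [← hm]
  rw [max_eq_right hab.le] at hm
  have E : ∀ u v, dist (g u) (g v) = dist u v := g.dist_eq
  have e1 : dist (g (g x)) (g (g m)) = dist (g (g x)) (g (g (g x))) / 2 := by
    simpa only [E] using h1
  have e2 : dist (g (g m)) (g (g (g x))) = dist (g (g x)) (g (g (g x))) / 2 := by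
    simpa only [E] using h2
  have a1 := h.dist_midpoint e1 e2 m
  have a2 := h.dist_midpoint h1 h2 (g (g x))
  have a3 := h.dist_midpoint h1 h2 (g (g (g x)))
  rw [dist_comm (g (g m)) m, dist_comm (g (g x)) m, dist_comm (g (g (g x))) m, a2, a3] at a1
  simp only [E] at a1
  have hc : dist x (g (g (g x))) = 2 * dist x (g (g x)) - dist x (g x) := by
    have t := dist_triangle x (g x) (g (g (g x)))
    have t2 := dist_triangle x (g x) (g (g x))
    have f := h.four_point x (g (g x)) (g x) (g (g (g x)))
    have f' := h.four_point x (g (g (g x))) (g x) (g (g x))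
    rw [dist_comm (g (g (g x))) (g (g x)), dist_comm (g (g (g x))) (g x)] at f'
    rw [dist_comm (g (g x)) (g x)] at f
    simp only [E] at f f' t t2
    rcases f with f | f <;> rcases f' with f' | f' <;> linarith
  have k1 : max (dist x (g (g x))) (dist x (g x)) = dist x (g (g x)) := max_eq_left hab.le
  have k2 : max (dist x (g (g (g x)))) (dist x (g (g x))) = dist x (g (g (g x))) :=
    max_eq_left (by linarith)
  rw [k1, k2, hc, max_eq_right (by linarith)] at a1
  rw [a1, hm]; ring

lemma IsRTree.isometryAxis_nonempty (h : IsRTree T) [Nonempty T] (g : T ≃ᵢ T) :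
    (isometryAxis g).Nonempty := by
  obtain ⟨m, h1, h2⟩ := h.1.exists_midpoint (Classical.arbitrary T) (g (Classical.arbitrary T))
  exact ⟨m, h.2.midpoint_mem_isometryAxis g h1 h2⟩

lemma ZeroHyp.dist_pow (h : ZeroHyp T) {g : T ≃ᵢ T} {m : T} (hm : m ∈ isometryAxis g)
    (hne : g m ≠ m) (n : ℕ) :
    dist m ((g ^ n) m) = n * dist m (g m) := by
  have hpos : 0 < dist m (g m) := dist_pos.2 (Ne.symm hne)
  have hm' : dist m (g (g m)) = 2 * dist m (g m) := hm
  have key : dist m ((g ^ n) m) = n * dist m (g m) ∧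
      dist m ((g ^ (n + 1)) m) = (n + 1 : ℕ) * dist m (g m) := by
    induction n with
    | zero => simp
    | succ n ih =>
      refine ⟨ih.2, ?_⟩
      obtain ⟨ih1, ih2⟩ := ih
      have s1 : (g ^ (n + 1)) m = (g ^ n) (g m) := by rw [pow_succ]; rfl
      have s2 : (g ^ (n + 1 + 1)) m = (g ^ n) (g (g m)) := by rw [pow_succ, pow_succ]; rfl
      have f := h.four_point m ((g ^ (n + 1)) m) ((g ^ n) m) ((g ^ (n + 1 + 1)) m)
      have t := dist_triangle m ((g ^ (n + 1)) m) ((g ^ (n + 1 + 1)) m)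
      rw [dist_comm ((g ^ (n + 1)) m) ((g ^ n) m)] at f
      rw [ih2] at f t
      rw [ih1] at f
      rw [s1, s2, (g ^ n).dist_eq, (g ^ n).dist_eq, (g ^ n).dist_eq, g.dist_eq] at f
      rw [s1, s2, (g ^ n).dist_eq, g.dist_eq] at t
      rw [s2]
      push_cast at *
      rcases f with f | f <;> linarith
  exact key.1

lemma ZeroHyp.displacement_eq (h : ZeroHyp T) {g : T ≃ᵢ T} (hg : ∀ x, g x ≠ x) {m p : T}
    (hm : m ∈ isometryAxis g) (hp : p ∈ isometryAxis g) : dist m (g m) ≤ dist p (g p) := by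
  by_contra! hlt
  obtain ⟨n, hn⟩ := exists_nat_gt (2 * dist m p / (dist m (g m) - dist p (g p)))
  rw [div_lt_iff₀ (by linarith)] at hn
  have e1 := h.dist_pow hm (hg m) n
  have e2 := h.dist_pow hp (hg p) n
  have t1 := dist_triangle4 m p ((g ^ n) p) ((g ^ n) m)
  rw [(g ^ n).dist_eq, dist_comm p m] at t1
  nlinarith

lemma IsRTree.mem_isometryAxis_iff (h : IsRTree T) {g : T ≃ᵢ T} (hg : ∀ x, g x ≠ x) {p : T} :
    p ∈ isometryAxis g ↔ ∀ y, dist p (g p) ≤ dist y (g y) := by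
  constructor
  · intro hp y
    obtain ⟨m, h1, h2⟩ := h.1.exists_midpoint y (g y)
    refine (h.2.displacement_eq hg hp (h.2.midpoint_mem_isometryAxis g h1 h2)).trans ?_
    rw [h.2.dist_midpoint_map g h1 h2, sub_le_iff_le_add]
    have t := dist_triangle y (g y) (g (g y))
    rw [g.dist_eq] at t
    exact max_le (by linarith [dist_nonneg (x := y) (y := g y)]) t
  · intro hp
    obtain ⟨m, h1, h2⟩ := h.1.exists_midpoint p (g p)
    have hm := h.2.dist_midpoint_map g h1 h2
    have hpos : 0 < dist p (g p) := dist_pos.2 (Ne.symm (hg p))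
    have t := dist_triangle p (g p) (g (g p))
    rw [g.dist_eq] at t
    have := hp m
    change dist p (g (g p)) = 2 * dist p (g p)
    rcases max_cases (dist p (g p)) (dist p (g (g p))) with ⟨k, -⟩ | ⟨k, -⟩ <;>
      rw [k] at hm <;> linarith

lemma IsRTree.isMetricConvex_isometryAxis (h : IsRTree T) {g : T ≃ᵢ T} (hg : ∀ x, g x ≠ x) :
    IsMetricConvex (isometryAxis g) := by
  intro x hx y hy z hz
  rw [h.mem_isometryAxis_iff hg] at *
  exact fun w ↦ h.2.displacement_le g (hx w) (hy w) hz

lemma map_mem_isometryAxis {g k : T ≃ᵢ T} (hgk : Commute g k) {x : T}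
    (hx : x ∈ isometryAxis g) : k x ∈ isometryAxis g := by
  have hc : ∀ y, g (k y) = k (g y) := fun y ↦ DFunLike.congr_fun hgk.eq y
  change dist _ _ = _
  rw [hc, hc, k.dist_eq, k.dist_eq]
  exact hx

lemma ZeroHyp.dist_pow_inv_pow (h : ZeroHyp T) {g : T ≃ᵢ T} {m : T} (hm : m ∈ isometryAxis g)
    (hne : g m ≠ m) (n k : ℕ) :
    dist ((g⁻¹ ^ n) m) ((g ^ k) m) = (n + k) * dist m (g m) := by
  rw [← (g ^ n).dist_eq, ← IsometryEquiv.mul_apply, ← IsometryEquiv.mul_apply, ← pow_add,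
    inv_pow, mul_inv_cancel, IsometryEquiv.coe_one, id, h.dist_pow hm hne]
  push_cast; rfl

/-- Any two points of the axis of `g` are such that one lies between far away translates of the
other. -/
lemma ZeroHyp.between_pow (h : ZeroHyp T) {g : T ≃ᵢ T} (hg : ∀ x, g x ≠ x) {m p : T}
    (hm : m ∈ isometryAxis g) (hp : p ∈ isometryAxis g) {n : ℕ}
    (hn : dist m p < n * dist m (g m)) :
    dist ((g⁻¹ ^ n) m) p + dist p ((g ^ n) m) = dist ((g⁻¹ ^ n) m) ((g ^ n) m) := by
  have hl : dist p (g p) = dist m (g m) :=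
    le_antisymm (h.displacement_eq hg hp hm) (h.displacement_eq hg hm hp)
  have a1 := h.dist_pow_inv_pow hm (hg m) n n
  have a2 := h.dist_pow_inv_pow hp (hg p) n n
  have a3 := h.dist_pow_inv_pow hp (hg p) n 0
  have a4 := h.dist_pow_inv_pow hp (hg p) 0 n
  rw [hl] at a2 a3 a4
  simp only [pow_zero, IsometryEquiv.coe_one, id] at a3 a4
  have a5 := (g⁻¹ ^ n).dist_eq m p
  have a6 := (g ^ n).dist_eq m p
  set u := (g⁻¹ ^ n) m
  set v := (g ^ n) m
  set u' := (g⁻¹ ^ n) p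
  set v' := (g ^ n) p
  push_cast at *
  have t := dist_triangle u p v
  have t1 := dist_triangle p u u'
  have t2 := dist_triangle p v v'
  have t3 := dist_triangle p u' u
  have t4 := dist_triangle p v' v
  have f1 := h p u' v' u
  have f2 := h p u v' v
  simp only [min_le_iff] at f1 f2
  have c1 := dist_comm u u'
  have c2 := dist_comm v v'
  have c3 := dist_comm p u
  have c4 := dist_comm p u'
  have c5 := dist_comm p v
  have c6 := dist_comm p v'
  rcases f1 with f1 | f1
  · linarith
  rcases f2 with f2 | f2 <;> linarith

/-- The axis of a fixed-point free isometry `g` is the least nonempty convex set invariant under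
`g` and its inverse. -/
lemma IsRTree.isometryAxis_subset (h : IsRTree T) {g : T ≃ᵢ T} (hg : ∀ x, g x ≠ x) {C : Set T}
    (hne : C.Nonempty) (hC : IsMetricConvex C) (h1 : ∀ x ∈ C, g x ∈ C)
    (h2 : ∀ x ∈ C, g⁻¹ x ∈ C) : isometryAxis g ⊆ C := by
  intro p hp
  obtain ⟨c, hc⟩ := hne
  obtain ⟨m, hm1, hm2⟩ := h.1.exists_midpoint c (g c)
  have hm := h.2.midpoint_mem_isometryAxis g hm1 hm2
  have hmC : m ∈ C := hC c hc _ (h1 c hc) m (by linarith)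
  have hpow : ∀ k : T ≃ᵢ T, (∀ x ∈ C, k x ∈ C) → ∀ n : ℕ, (k ^ n) m ∈ C := by
    intro k hk n
    induction n with
    | zero => simpa
    | succ n ih => rw [pow_succ']; exact hk _ ih
  have hpos : 0 < dist m (g m) := dist_pos.2 (Ne.symm (hg m))
  obtain ⟨n, hn⟩ := exists_nat_gt (dist m p / dist m (g m))
  rw [div_lt_iff₀ hpos] at hn
  exact hC _ (hpow _ h2 n) _ (hpow _ h1 n) p (h.2.between_pow hg hm hp hn)

/-- An ℝ-tree which is the axis of a fixed-point free isometry is isometric to `ℝ`. -/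
lemma IsRTree.exists_isometry_real (h : IsRTree T) [Nonempty T] {g : T ≃ᵢ T}
    (hg : ∀ x, g x ≠ x) (hax : isometryAxis g = Set.univ) :
    ∃ f : T → ℝ, Isometry f ∧ Function.Surjective f := by
  have hm (p : T) : p ∈ isometryAxis g := hax ▸ Set.mem_univ p
  set m : T := Classical.arbitrary T
  have hpos : 0 < dist m (g m) := dist_pos.2 (Ne.symm (hg m))
  set l := dist m (g m) with hl
  set u : ℕ → T := fun n ↦ (g⁻¹ ^ n) m
  set v : ℕ → T := fun n ↦ (g ^ n) m
  have huv (n k : ℕ) : dist (u n) (v k) = (n + k) * l := h.2.dist_pow_inv_pow (hm m) (hg m) n k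
  have huu (n k : ℕ) : dist (u (n + k)) (u n) = k * l := by
    have := (g⁻¹ ^ n).dist_eq ((g⁻¹ ^ k) m) m
    rw [← IsometryEquiv.mul_apply, ← pow_add] at this
    have h2 := huv k 0
    simp only [v, pow_zero, IsometryEquiv.coe_one, id, Nat.cast_zero, add_zero] at h2
    rw [← h2, ← this]
  have hvv (n k : ℕ) : dist (v n) (v (n + k)) = k * l := by
    simp only [v, pow_add, IsometryEquiv.mul_apply, (g ^ n).dist_eq]
    exact h.2.dist_pow (hm m) (hg m) k
  let P (p : T) (n : ℕ) : Prop := dist (u n) p + dist p (v n) = dist (u n) (v n)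
  have hstep (p : T) (n k : ℕ) (hP : P p n) :
      P p (n + k) ∧ dist (u (n + k)) p = dist (u n) p + k * l := by
    have hP' : _ = _ := hP
    have b1 := huv n n
    have b2 := huv (n + k) n
    have b3 := huv (n + k) (n + k)
    have b4 := huu n k
    have b5 := hvv n k
    have t1 := dist_triangle (u (n + k)) (u n) p
    have t2 := dist_triangle p (v n) (v (n + k))
    have t3 := dist_triangle (u (n + k)) p (v n)
    have t4 := dist_triangle (u (n + k)) p (v (n + k))
    push_cast at *
    refine ⟨?_, by linarith⟩
    change _ = _
    linarith
  have hex (p : T) : ∃ n, P p n := by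
    obtain ⟨n, hn⟩ := exists_nat_gt (dist m p / l)
    rw [div_lt_iff₀ hpos] at hn
    exact ⟨n, h.2.between_pow hg (hm m) (hm p) hn⟩
  choose N hN using hex
  set f : T → ℝ := fun p ↦ dist (u (N p)) p - N p * l
  have hf (p : T) (n : ℕ) (hP : P p n) : f p = dist (u n) p - n * l := by
    change dist (u (N p)) p - N p * l = _
    rcases le_total n (N p) with hle | hle
    · obtain ⟨k, hk⟩ := Nat.exists_eq_add_of_le hle
      rw [hk, (hstep p n k hP).2]; push_cast; ring
    · obtain ⟨k, hk⟩ := Nat.exists_eq_add_of_le hle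
      rw [hk, (hstep p _ k (hN p)).2]; push_cast; ring
  refine ⟨f, Isometry.of_dist_eq fun p q ↦ ?_, fun t ↦ ?_⟩
  · have h1 := (hstep p (N p) (N q) (hN p)).1
    have h2 := (hstep q (N q) (N p) (hN q)).1
    rw [add_comm] at h2
    rw [Real.dist_eq, hf p _ h1, hf q _ h2]
    set n := N p + N q
    have h1' : _ = _ := h1
    have h2' : _ = _ := h2
    have t1 := dist_triangle (u n) p q
    have t2 := dist_triangle (u n) q p
    have c1 := dist_comm p q
    have c2 := dist_comm p (u n)
    have c3 := dist_comm q (u n)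
    apply le_antisymm
    · rw [abs_le]; constructor <;> linarith
    · rw [le_abs]
      rcases h.2.four_point p q (u n) (v n) with f1 | f1
      · left; linarith
      · right; linarith
  · obtain ⟨n, hn⟩ := exists_nat_gt (|t| / l)
    rw [div_lt_iff₀ hpos] at hn
    obtain ⟨ht1, ht2⟩ := abs_lt.1 hn
    obtain ⟨p, hp1, hp2⟩ := h.1.exists_dist_eq (u n) (v n) (t := t + n * l)
      (by rw [huv]; constructor <;> linarith)
    refine ⟨p, ?_⟩
    rw [hf p n (by change _ = _; linarith), hp1]; ring

end RTree

section Action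

variable {T H : Type} [MetricSpace T] [Group H]

/-- The homomorphism to the isometry group attached to an isometric action. -/
def IsometricAction.toHom {φ : H → T → T} (hφ : IsometricAction φ) : H →* (T ≃ᵢ T) where
  toFun h :=
    { toFun := φ h
      invFun := φ h⁻¹
      left_inv := fun x ↦ by rw [← hφ.2.2, inv_mul_cancel, hφ.2.1]
      right_inv := fun x ↦ by rw [← hφ.2.2, mul_inv_cancel, hφ.2.1]
      isometry_toFun := hφ.1 h }
  map_one' := by ext x; exact hφ.2.1 x
  map_mul' g h := by ext x; exact hφ.2.2 g h x

/-- There is no proper nonempty invariant convex subspace. -/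
def EssentialAction (φ : H → T → T) : Prop :=
  ∀ C : Set T, C.Nonempty → (∀ h, ∀ x ∈ C, φ h x ∈ C) → IsMetricConvex C → C = Set.univ

lemma exists_mul_of_commute {H₁ H₂ : Subgroup H} (hcomm : ∀ a ∈ H₁, ∀ b ∈ H₂, a * b = b * a)
    (hsup : H₁ ⊔ H₂ = ⊤) (h : H) : ∃ a ∈ H₁, ∃ b ∈ H₂, h = a * b := by
  let K : Subgroup H :=
    { carrier := {h | ∃ a ∈ H₁, ∃ b ∈ H₂, h = a * b}
      one_mem' := ⟨1, H₁.one_mem, 1, H₂.one_mem, by simp⟩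
      mul_mem' := by
        rintro _ _ ⟨a, ha, b, hb, rfl⟩ ⟨c, hc, d, hd, rfl⟩
        refine ⟨a * c, H₁.mul_mem ha hc, b * d, H₂.mul_mem hb hd, ?_⟩
        rw [mul_assoc, ← mul_assoc b, ← hcomm c hc b hb, mul_assoc, mul_assoc]
      inv_mem' := by
        rintro _ ⟨a, ha, b, hb, rfl⟩
        refine ⟨a⁻¹, H₁.inv_mem ha, b⁻¹, H₂.inv_mem hb, ?_⟩
        rw [hcomm a ha b hb, mul_inv_rev] }
  have hK : H₁ ⊔ H₂ ≤ K := sup_le (fun a ha ↦ ⟨a, ha, 1, H₂.one_mem, by simp⟩)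
    (fun b hb ↦ ⟨1, H₁.one_mem, b, hb, by simp⟩)
  exact hK (hsup ▸ Subgroup.mem_top h)

/-- If commuting subgroups generating `H` both contain fixed-point free elements, then the
axes coincide, so that an essential action forces the tree to be a line. -/
lemma IsRTree.exists_fixed_of_commute (hT : IsRTree T) [Nonempty T]
    (hnl : ¬ ∃ f : T → ℝ, Isometry f ∧ Function.Surjective f) {φ : H → T → T}
    (hφ : IsometricAction φ) (hess : EssentialAction φ) {H₁ H₂ : Subgroup H}
    (hcomm : ∀ a ∈ H₁, ∀ b ∈ H₂, a * b = b * a) (hsup : H₁ ⊔ H₂ = ⊤) {a b : H}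
    (ha : a ∈ H₁) (hfix : ∀ x, φ a x ≠ x) (hb : b ∈ H₂) : ∃ x, φ b x = x := by
  by_contra! hfix'
  let A := hφ.toHom
  have hA : ∀ h x, A h x = φ h x := fun _ _ ↦ rfl
  have hAB : ∀ a ∈ H₁, ∀ b ∈ H₂, Commute (A a) (A b) := fun a ha b hb ↦
    (show Commute a b from hcomm a ha b hb).map A
  have hsub : isometryAxis (A b) ⊆ isometryAxis (A a) :=
    hT.isometryAxis_subset hfix' (hT.isometryAxis_nonempty _) (hT.isMetricConvex_isometryAxis hfix)
      (fun x hx ↦ map_mem_isometryAxis (hAB a ha b hb) hx)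
      (fun x hx ↦ map_mem_isometryAxis (hAB a ha b hb).inv_right hx)
  have hsub' : isometryAxis (A a) ⊆ isometryAxis (A b) :=
    hT.isometryAxis_subset hfix (hT.isometryAxis_nonempty _) (hT.isMetricConvex_isometryAxis hfix')
      (fun x hx ↦ map_mem_isometryAxis (hAB a ha b hb).symm hx)
      (fun x hx ↦ map_mem_isometryAxis (hAB a ha b hb).symm.inv_right hx)
  have huniv := hess (isometryAxis (A a)) (hT.isometryAxis_nonempty _) (fun h x hx ↦ by
    obtain ⟨c, hc, d, hd, rfl⟩ := exists_mul_of_commute hcomm hsup h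
    rw [hφ.2.2]
    exact hsub (map_mem_isometryAxis (hAB c hc b hb).symm
      (hsub' (map_mem_isometryAxis (hAB a ha d hd) hx)))) (hT.isMetricConvex_isometryAxis hfix)
  exact hnl (hT.exists_isometry_real hfix huniv)

lemma ZeroHyp.eq_of_between (h : ZeroHyp T) {x y p q : T}
    (hp : dist x p + dist p y = dist x y) (hxq : dist x q = dist x p) (hqy : dist q y = dist p y) :
    p = q := by
  have := dist_comm q y
  rw [← dist_le_zero]
  rcases h.dist_le_of_between hp q with h1 | h1 <;> linarith

/-- If a subgroup consisting of elliptic elements commutes with a fixed-point free element of the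
complementary factor, then it acts trivially. -/
lemma IsRTree.eq_of_commute (hT : IsRTree T) [Nonempty T] {φ : H → T → T}
    (hφ : IsometricAction φ) (hess : EssentialAction φ) {H₁ H₂ : Subgroup H}
    (hcomm : ∀ a ∈ H₁, ∀ b ∈ H₂, a * b = b * a) (hsup : H₁ ⊔ H₂ = ⊤) {a : H}
    (ha : a ∈ H₁) (hfix : ∀ x, φ a x ≠ x) (hell : ∀ b ∈ H₂, ∃ x, φ b x = x) :
    ∀ b ∈ H₂, ∀ x, φ b x = x := by
  let A := hφ.toHom
  have hconv : ∀ b, IsMetricConvex {x | φ b x = x} := by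
    intro b x hx y hy z hz
    have e1 := (hφ.1 b).dist_eq x z
    have e2 := (hφ.1 b).dist_eq z y
    rw [show φ b x = x from hx] at e1
    rw [show φ b y = y from hy] at e2
    exact (hT.2.eq_of_between hz e1 e2).symm
  have hmap : ∀ a ∈ H₁, ∀ b ∈ H₂, ∀ x, φ b x = x → φ b (φ a x) = φ a x := by
    intro a ha b hb x hx
    rw [← hφ.2.2, ← hcomm a ha b hb, hφ.2.2, hx]
  have haxis : ∀ b ∈ H₂, isometryAxis (A a) ⊆ {x | φ b x = x} := by
    intro b hb
    refine hT.isometryAxis_subset hfix (hell b hb) (hconv b) (hmap a ha b hb) fun x hx ↦ ?_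
    rw [← map_inv]
    exact hmap a⁻¹ (H₁.inv_mem ha) b hb x hx
  have huniv := hess {x | ∀ b ∈ H₂, φ b x = x}
    ((hT.isometryAxis_nonempty (A a)).mono fun x hx b hb ↦ haxis b hb hx)
    (fun h x hx b hb ↦ by
      obtain ⟨c, hc, d, hd, rfl⟩ := exists_mul_of_commute hcomm hsup h
      rw [hφ.2.2, hx d hd]
      exact hmap c hc b hb x (hx b hb))
    (fun x hx y hy z hz b hb ↦ hconv b x (hx b hb) y (hy b hb) z hz)
  intro b hb x
  have hx : x ∈ {x | ∀ b ∈ H₂, φ b x = x} := huniv ▸ Set.mem_univ x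
  exact hx b hb

end Action

section Product

variable {T₁ T₂ H : Type} [MetricSpace T₁] [MetricSpace T₂] [Group H]
  {α : H → T₁ → T₁} {β : H → T₂ → T₂}

lemma EssentialOn.fst [Nonempty T₂] (hα : IsometricAction α) (hβ : IsometricAction β)
    (hess : EssentialOn (prodAct α β) Set.univ Set.univ) : EssentialAction α := by
  intro C ⟨c, hc⟩ hinv hconv
  have himg : ∀ h, prodAct α β h '' {p | p.1 ∈ C} = {p | p.1 ∈ C} := by
    intro h
    refine Set.Subset.antisymm (Set.image_subset_iff.2 fun p hp ↦ hinv h _ hp) fun p hp ↦ ?_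
    refine ⟨(α h⁻¹ p.1, β h⁻¹ p.2), hinv h⁻¹ _ hp, Prod.ext ?_ ?_⟩
    · change α h (α h⁻¹ p.1) = p.1
      rw [← hα.2.2, mul_inv_cancel, hα.2.1]
    · change β h (β h⁻¹ p.2) = p.2
      rw [← hβ.2.2, mul_inv_cancel, hβ.2.1]
  have huniv := hess {p | p.1 ∈ C} (Set.subset_univ _) ⟨(c, Classical.arbitrary T₂), hc⟩
    (fun h _ ↦ himg h) (fun x hx y hy z _ hz ↦ hconv _ hx _ hy _ (by
      unfold l1dist2 at hz
      linarith [dist_triangle x.1 z.1 y.1, dist_triangle x.2 z.2 y.2]))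
  refine Set.eq_univ_of_forall fun x ↦ ?_
  have hx : (x, Classical.arbitrary T₂) ∈ {p : T₁ × T₂ | p.1 ∈ C} := huniv ▸ Set.mem_univ _
  exact hx

lemma EssentialOn.snd [Nonempty T₁] (hα : IsometricAction α) (hβ : IsometricAction β)
    (hess : EssentialOn (prodAct α β) Set.univ Set.univ) : EssentialAction β := by
  intro C ⟨c, hc⟩ hinv hconv
  have himg : ∀ h, prodAct α β h '' {p | p.2 ∈ C} = {p | p.2 ∈ C} := by
    intro h
    refine Set.Subset.antisymm (Set.image_subset_iff.2 fun p hp ↦ hinv h _ hp) fun p hp ↦ ?_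
    refine ⟨(α h⁻¹ p.1, β h⁻¹ p.2), hinv h⁻¹ _ hp, Prod.ext ?_ ?_⟩
    · change α h (α h⁻¹ p.1) = p.1
      rw [← hα.2.2, mul_inv_cancel, hα.2.1]
    · change β h (β h⁻¹ p.2) = p.2
      rw [← hβ.2.2, mul_inv_cancel, hβ.2.1]
  have huniv := hess {p | p.2 ∈ C} (Set.subset_univ _) ⟨(Classical.arbitrary T₁, c), hc⟩
    (fun h _ ↦ himg h) (fun x hx y hy z _ hz ↦ hconv _ hx _ hy _ (by
      unfold l1dist2 at hz
      linarith [dist_triangle x.1 z.1 y.1, dist_triangle x.2 z.2 y.2]))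
  refine Set.eq_univ_of_forall fun x ↦ ?_
  have hx : (Classical.arbitrary T₁, x) ∈ {p : T₁ × T₂ | p.2 ∈ C} := huniv ▸ Set.mem_univ _
  exact hx

lemma setStab_slice₁ [Nonempty T₁] (hα : IsometricAction α) (z₂ : T₂) :
    setStab (prodAct α β) (slice₁ z₂) = {h | β h z₂ = z₂} := by
  ext h
  constructor
  · intro hh
    have hmem : (Classical.arbitrary T₁, z₂) ∈ slice₁ z₂ := rfl
    have := Set.mem_image_of_mem (prodAct α β h) hmem
    rw [show prodAct α β h '' slice₁ z₂ = slice₁ z₂ from hh] at this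
    exact this
  · intro hh
    refine Set.Subset.antisymm ?_ ?_
    · rintro _ ⟨⟨x, _⟩, rfl, rfl⟩
      exact hh
    · rintro ⟨x, _⟩ rfl
      refine ⟨(α h⁻¹ x, _), rfl, Prod.ext ?_ hh⟩
      change α h (α h⁻¹ x) = x
      rw [← hα.2.2, mul_inv_cancel, hα.2.1]

lemma setStab_slice₂ [Nonempty T₂] (hβ : IsometricAction β) (z₁ : T₁) :
    setStab (prodAct α β) (slice₂ z₁) = {h | α h z₁ = z₁} := by
  ext h
  constructor
  · intro hh
    have hmem : (z₁, Classical.arbitrary T₂) ∈ slice₂ z₁ := rfl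
    have := Set.mem_image_of_mem (prodAct α β h) hmem
    rw [show prodAct α β h '' slice₂ z₁ = slice₂ z₁ from hh] at this
    exact this
  · intro hh
    refine Set.Subset.antisymm ?_ ?_
    · rintro _ ⟨⟨_, x⟩, rfl, rfl⟩
      exact hh
    · rintro ⟨_, x⟩ rfl
      refine ⟨(_, β h⁻¹ x), rfl, Prod.ext hh ?_⟩
      change β h (β h⁻¹ x) = x
      rw [← hβ.2.2, mul_inv_cancel, hβ.2.1]

lemma factorConclusion_of_trivial (hα : IsometricAction α) (hβ : IsometricAction β)
    (hfree : FreeOn (prodAct α β) Set.univ Set.univ)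
    (hess₁ : EssentialAction α) (hess₂ : EssentialAction β) {K₁ K₂ : Subgroup H}
    (hfac : ∀ h, ∃ a ∈ K₁, ∃ b ∈ K₂, h = a * b)
    (h₁ : ∀ a ∈ K₁, ∀ x, β a x = x) (h₂ : ∀ b ∈ K₂, ∀ x, α b x = x) :
    FactorConclusion (prodAct α β) K₁ K₂ := by
  intro z₁ z₂
  have : Nonempty T₁ := ⟨z₁⟩
  have : Nonempty T₂ := ⟨z₂⟩
  have hα' : ∀ h, ∃ a ∈ K₁, ∀ x, α h x = α a x := by
    intro h
    obtain ⟨a, ha, b, hb, rfl⟩ := hfac h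
    exact ⟨a, ha, fun x ↦ by rw [hα.2.2, h₂ b hb]⟩
  have hβ' : ∀ h, ∃ b ∈ K₂, ∀ x, β h x = β b x := by
    intro h
    obtain ⟨a, ha, b, hb, rfl⟩ := hfac h
    exact ⟨b, hb, fun x ↦ by rw [hβ.2.2, h₁ a ha]⟩
  refine ⟨?_, ?_, fun h _ p _ ↦ hfree h trivial p trivial, ?_,
    fun h _ p _ ↦ hfree h trivial p trivial, ?_, ?_, ?_, ?_⟩
  · rw [setStab_slice₁ hα]
    ext h
    refine ⟨fun hh ↦ h₁ h hh z₂, fun hh ↦ ?_⟩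
    obtain ⟨a, ha, b, hb, rfl⟩ := hfac h
    have hb1 : b = 1 := hfree b trivial (z₁, z₂) trivial (Prod.ext (h₂ b hb z₁) (by
      rw [Set.mem_ofPred_eq, hβ.2.2, h₁ a ha] at hh
      exact hh))
    simpa [hb1] using ha
  · rw [setStab_slice₂ hβ]
    ext h
    refine ⟨fun hh ↦ h₂ h hh z₁, fun hh ↦ ?_⟩
    obtain ⟨a, ha, b, hb, rfl⟩ := hfac h
    have ha1 : a = 1 := hfree a trivial (z₁, z₂) trivial (Prod.ext (by
      rw [Set.mem_ofPred_eq, hα.2.2, h₂ b hb] at hh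
      exact hh) (h₁ a ha z₂))
    simpa [ha1] using hb
  · intro C hC ⟨c, hc⟩ hinv hconv
    have hmem : ∀ p ∈ C, p = (p.1, z₂) := fun p hp ↦ Prod.ext rfl (hC hp)
    have huniv := hess₁ {x | (x, z₂) ∈ C} ⟨c.1, hmem c hc ▸ hc⟩ (fun h x hx ↦ by
        obtain ⟨a, ha, hax⟩ := hα' h
        have := hinv a ha ▸ Set.mem_image_of_mem (prodAct α β a) hx
        rw [prodAct, h₁ a ha] at this
        rw [hax]
        exact this)
      (fun x hx y hy z hz ↦ hconv _ hx _ hy _ rfl (by simpa [l1dist2] using hz))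
    refine Set.Subset.antisymm hC ?_
    rintro ⟨x, _⟩ rfl
    have hx : x ∈ {x | (x, _) ∈ C} := huniv ▸ Set.mem_univ x
    exact hx
  · intro C hC ⟨c, hc⟩ hinv hconv
    have hmem : ∀ p ∈ C, p = (z₁, p.2) := fun p hp ↦ Prod.ext (hC hp) rfl
    have huniv := hess₂ {x | (z₁, x) ∈ C} ⟨c.2, hmem c hc ▸ hc⟩ (fun h x hx ↦ by
        obtain ⟨b, hb, hbx⟩ := hβ' h
        have := hinv b hb ▸ Set.mem_image_of_mem (prodAct α β b) hx
        rw [prodAct, h₂ b hb] at this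
        rw [hbx]
        exact this)
      (fun x hx y hy z hz ↦ hconv _ hx _ hy _ rfl (by simpa [l1dist2] using hz))
    refine Set.Subset.antisymm hC ?_
    rintro ⟨_, x⟩ rfl
    have hx : x ∈ {x | (_, x) ∈ C} := huniv ▸ Set.mem_univ x
    exact hx
  · rintro ⟨⟨x₁, x₂⟩, -, R, hR, hx⟩
    refine ⟨⟨(x₁, z₂), rfl, R, hR, ?_⟩, ⟨(z₁, x₂), rfl, R, hR, ?_⟩⟩
    · rintro ⟨y, z₂⟩ rfl
      obtain ⟨h, -, hh⟩ := hx (y, z₂) trivial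
      obtain ⟨a, ha, hax⟩ := hα' h
      refine ⟨a, ha, ?_⟩
      simp only [l1dist2, prodAct, hax, h₁ a ha, dist_self] at hh ⊢
      linarith [dist_nonneg (x := z₂) (y := β h x₂)]
    · rintro ⟨z₁, y⟩ rfl
      obtain ⟨h, -, hh⟩ := hx (z₁, y) trivial
      obtain ⟨b, hb, hbx⟩ := hβ' h
      refine ⟨b, hb, ?_⟩
      simp only [l1dist2, prodAct, hbx, h₂ b hb, dist_self] at hh ⊢
      linarith [dist_nonneg (x := z₁) (y := α h x₁)]
  · rintro ⟨C, -, hC, hcov⟩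
    refine ⟨⟨(fun p ↦ (p.1, z₂)) '' C, ?_, hC.image (by fun_prop), ?_⟩,
      ⟨(fun p ↦ (z₁, p.2)) '' C, ?_, hC.image (by fun_prop), ?_⟩⟩
    · rintro _ ⟨p, -, rfl⟩
      rfl
    · rintro ⟨y, z₂⟩ rfl
      obtain ⟨h, -, c, hc, hh⟩ := hcov (y, z₂) trivial
      obtain ⟨a, ha, hax⟩ := hα' h
      exact ⟨a, ha, _, ⟨c, hc, rfl⟩,
        Prod.ext ((hax c.1).symm.trans (congrArg Prod.fst hh)) (h₁ a ha _)⟩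
    · rintro _ ⟨p, -, rfl⟩
      rfl
    · rintro ⟨z₁, y⟩ rfl
      obtain ⟨h, -, c, hc, hh⟩ := hcov (z₁, y) trivial
      obtain ⟨b, hb, hbx⟩ := hβ' h
      exact ⟨b, hb, _, ⟨c, hc, rfl⟩,
        Prod.ext (h₂ b hb _) ((hbx c.2).symm.trans (congrArg Prod.snd hh))⟩
  · intro htrans
    refine ⟨?_, ?_⟩
    · rintro ⟨x, _⟩ rfl ⟨y, w⟩ (rfl : w = _)
      obtain ⟨h, -, hh⟩ := htrans (x, w) trivial (y, w) trivial
      obtain ⟨a, ha, hax⟩ := hα' h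
      exact ⟨a, ha, Prod.ext ((hax x).symm.trans (congrArg Prod.fst hh)) (h₁ a ha _)⟩
    · rintro ⟨_, x⟩ rfl ⟨w, y⟩ (rfl : w = _)
      obtain ⟨h, -, hh⟩ := htrans (w, x) trivial (w, y) trivial
      obtain ⟨b, hb, hbx⟩ := hβ' h
      exact ⟨b, hb, Prod.ext (h₂ b hb _) ((hbx x).symm.trans (congrArg Prod.snd hh))⟩

/-- The conclusion holds as soon as some element of `H₁` has no fixed point in `T₁`. -/
lemma factorConclusion_of_fixedPointFree [Nonempty T₁] [Nonempty T₂]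
    (hT₁ : IsRTree T₁) (hT₂ : IsRTree T₂)
    (hnl₁ : ¬ ∃ f : T₁ → ℝ, Isometry f ∧ Function.Surjective f)
    (hnl₂ : ¬ ∃ f : T₂ → ℝ, Isometry f ∧ Function.Surjective f)
    (hα : IsometricAction α) (hβ : IsometricAction β) {H₁ H₂ : Subgroup H}
    (hcomm : ∀ a ∈ H₁, ∀ b ∈ H₂, a * b = b * a) (hsup : H₁ ⊔ H₂ = ⊤) (hnt₂ : H₂ ≠ ⊥)
    (hfree : FreeOn (prodAct α β) Set.univ Set.univ)
    (hess : EssentialOn (prodAct α β) Set.univ Set.univ)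
    {a : H} (ha : a ∈ H₁) (hfix : ∀ x, α a x ≠ x) :
    FactorConclusion (prodAct α β) H₁ H₂ := by
  have hess₁ := hess.fst hα hβ
  have hess₂ := hess.snd hα hβ
  have hcomm' : ∀ b ∈ H₂, ∀ a ∈ H₁, b * a = a * b := fun b hb a ha ↦ (hcomm a ha b hb).symm
  have hsup' : H₂ ⊔ H₁ = ⊤ := sup_comm H₁ H₂ ▸ hsup
  have hell₂ : ∀ b ∈ H₂, ∃ x, α b x = x := fun b hb ↦
    hT₁.exists_fixed_of_commute hnl₁ hα hess₁ hcomm hsup ha hfix hb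
  obtain ⟨b, hb, hb1⟩ := H₂.bot_or_exists_ne_one.resolve_left hnt₂
  obtain ⟨x, hx⟩ := hell₂ b hb
  have hbfix : ∀ y, β b y ≠ y := fun y hy ↦ hb1 (hfree b trivial (x, y) trivial (Prod.ext hx hy))
  have hell₁ : ∀ a ∈ H₁, ∃ x, β a x = x := fun a ha ↦
    hT₂.exists_fixed_of_commute hnl₂ hβ hess₂ hcomm' hsup' hb hbfix ha
  exact factorConclusion_of_trivial hα hβ hfree hess₁ hess₂ (exists_mul_of_commute hcomm hsup)
    (hT₂.eq_of_commute hβ hess₂ hcomm' hsup' hb hbfix hell₁)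
    (hT₁.eq_of_commute hα hess₁ hcomm hsup ha hfix hell₂)

end Product

/-- Let `T₁, T₂` be ℝ-trees, neither isometric to ℝ, and let `H = H₁ × H₂` be a subgroup
of `Isom(T₁) × Isom(T₂)` (a group acting factor-preservingly, by isometries on each
factor) with `H₁, H₂` nontrivial, whose action on the ℓ¹ product `X = T₁ × T₂` is free
and essential. Then, up to swapping `H₁` and `H₂`, for every `(z₁, z₂) ∈ X`:
`H₁ = Stab_H(T₁ × {z₂})` and `H₂ = Stab_H({z₁} × T₂)`, the induced actions on the slices
are free and essential, and coboundedness / cocompactness / transitivity of the `H`-action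
is inherited by the factor actions. -/
theorem stmt19 (T₁ T₂ : Type) [MetricSpace T₁] [MetricSpace T₂]
    (hT₁ : IsRTree T₁) (hT₂ : IsRTree T₂)
    (hnl₁ : ¬ ∃ f : T₁ → ℝ, Isometry f ∧ Function.Surjective f)
    (hnl₂ : ¬ ∃ f : T₂ → ℝ, Isometry f ∧ Function.Surjective f)
    (H : Type) [Group H] (α : H → T₁ → T₁) (β : H → T₂ → T₂)
    (hα : IsometricAction α) (hβ : IsometricAction β)
    (H₁ H₂ : Subgroup H)
    (hcomm : ∀ a ∈ H₁, ∀ b ∈ H₂, a * b = b * a)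
    (hinf : H₁ ⊓ H₂ = ⊥) (hsup : H₁ ⊔ H₂ = ⊤)
    (hnt₁ : H₁ ≠ ⊥) (hnt₂ : H₂ ≠ ⊥)
    (hfree : FreeOn (prodAct α β) Set.univ Set.univ)
    (hess : EssentialOn (prodAct α β) Set.univ Set.univ) :
    FactorConclusion (prodAct α β) H₁ H₂ ∨ FactorConclusion (prodAct α β) H₂ H₁ := by
  rcases isEmpty_or_nonempty T₁ with h1 | h1
  · exact Or.inl fun z₁ ↦ h1.elim z₁
  rcases isEmpty_or_nonempty T₂ with h2 | h2
  · exact Or.inl fun _ z₂ ↦ h2.elim z₂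
  have hcomm' : ∀ b ∈ H₂, ∀ a ∈ H₁, b * a = a * b := fun b hb a ha ↦ (hcomm a ha b hb).symm
  have hsup' : H₂ ⊔ H₁ = ⊤ := sup_comm H₁ H₂ ▸ hsup
  obtain ⟨a, ha, ha1⟩ := H₁.bot_or_exists_ne_one.resolve_left hnt₁
  by_cases hfix : ∃ x, α a x = x
  · right
    obtain ⟨x, hx⟩ := hfix
    have hafix : ∀ y, β a y ≠ y := fun y hy ↦
      ha1 (hfree a trivial (x, y) trivial (Prod.ext hx hy))
    obtain ⟨b, hb, hb1⟩ := H₂.bot_or_exists_ne_one.resolve_left hnt₂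
    obtain ⟨y, hy⟩ := hT₂.exists_fixed_of_commute hnl₂ hβ (hess.snd hα hβ) hcomm hsup ha hafix hb
    exact factorConclusion_of_fixedPointFree hT₁ hT₂ hnl₁ hnl₂ hα hβ hcomm' hsup' hnt₁ hfree hess
      hb fun x hx ↦ hb1 (hfree b trivial (x, y) trivial (Prod.ext hx hy))
  · left
    push Not at hfix
    exact factorConclusion_of_fixedPointFree hT₁ hT₂ hnl₁ hnl₂ hα hβ hcomm hsup hnt₂ hfree hess
      ha hfix
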